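/- arXiv:1706.06063 — 3 statements merged into one kernel-verified Lean document; each statement's English description precedes it below -/
import Mathlib

section
/- Let V be a finite-dimensional vector space over F₂ with a nondegenerate alternating bilinear form B, and let q be a quadratic refinement of B. Then there exists a unique function f_q : Sp(V) → F₂ such that (i) f_q(στ) + f_q(σ) + f_q(τ) = B(c_q(σ), σ(c_q(τ))) for all σ, τ ∈ Sp(V) (i.e. the coboundary of f_q is the cup-product cocycle c_q ∪ c_q), and (ii) f_q(σ) ≡ dim_{F₂} V^σ (mod 2) for every σ ∈ O(q). In particular, the 2-cocycle (σ,τ) ↦ B(c_q(σ), σ(c_q(τ))) on Sp(V) with values in F₂ is a coboundary, i.e. the class c ∪ c ∈ H²(Sp(V), F₂) is trivial. -/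
/-- The symplectic group of a bilinear form `B`, as a subtype of linear automorphisms. -/
abbrev SympGrp {V : Type*} [AddCommGroup V] [Module (ZMod 2) V]
    (B : V →ₗ[ZMod 2] V →ₗ[ZMod 2] ZMod 2) :=
  {σ : V ≃ₗ[ZMod 2] V // ∀ u w : V, B (σ u) (σ w) = B u w}

/-- The `F₂`-dimension of the fixed subspace `V^σ` of a linear automorphism `σ`. -/
noncomputable def fixedRank {V : Type*} [AddCommGroup V] [Module (ZMod 2) V]
    (σ : V ≃ₗ[ZMod 2] V) : ℕ :=
  Module.finrank (ZMod 2) ↥(LinearMap.ker (σ.toLinearMap - LinearMap.id))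

open Module

theorem even_finrank_add_finrank_ker_of_isAlt {E : Type*} [AddCommGroup E] [Module (ZMod 2) E]
    [FiniteDimensional (ZMod 2) E] (X : E →ₗ[ZMod 2] E →ₗ[ZMod 2] ZMod 2)
    (hX : ∀ x, X x x = 0) :
    Even (finrank (ZMod 2) E + finrank (ZMod 2) (LinearMap.ker X)) := by
  induction hn : finrank (ZMod 2) E using Nat.strong_induction_on generalizing E with
  | _ n ih =>
  by_cases h0 : X = 0
  · subst h0
    rw [LinearMap.ker_zero, finrank_top, hn]
    exact ⟨n, rfl⟩
  obtain ⟨u, hu⟩ : ∃ u, X u ≠ 0 := by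
    by_contra! h
    exact h0 (LinearMap.ext h)
  obtain ⟨w, huw⟩ : ∃ w, X u w ≠ 0 := by
    by_contra! h
    exact hu (LinearMap.ext h)
  replace huw : X u w = 1 := Fin.eq_one_of_ne_zero _ huw
  have hsymm (x y : E) : X x y = X y x := by
    have h := hX (x + y)
    simp only [map_add, LinearMap.add_apply, hX, zero_add, add_zero] at h
    exact (CharTwo.add_eq_zero.mp h).symm
  set φ : E →ₗ[ZMod 2] ZMod 2 × ZMod 2 := (X u).prod (X w) with hφ
  have hmem (x : E) : x ∈ LinearMap.ker φ ↔ X u x = 0 ∧ X w x = 0 := by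
    simp [hφ]
  have hsurj : LinearMap.range φ = ⊤ := by
    rw [LinearMap.range_eq_top]
    rintro ⟨a, b⟩
    exact ⟨b • u + a • w, by simp [hφ, hX, huw, hsymm w u]⟩
  have hdim := LinearMap.finrank_range_add_finrank_ker φ
  rw [hsurj, finrank_top, finrank_prod, finrank_self, hn] at hdim
  have hker : (LinearMap.ker (X.domRestrict₁₂ (LinearMap.ker φ) (LinearMap.ker φ))).map
      (LinearMap.ker φ).subtype = LinearMap.ker X := by
    ext x
    simp only [Submodule.mem_map, LinearMap.mem_ker, Submodule.subtype_apply, Subtype.exists,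
      exists_and_right, exists_eq_right]
    constructor
    · rintro ⟨hx, h⟩
      obtain ⟨hux, hwx⟩ := (hmem x).1 hx
      ext z
      have hz : z + X w z • u + X u z • w ∈ LinearMap.ker φ := by
        rw [hmem]
        simp [hX, huw, hsymm w u, CharTwo.add_self_eq_zero]
      have h' : X x (z + X w z • u + X u z • w) = 0 := LinearMap.congr_fun h ⟨_, hz⟩
      simpa [hsymm x u, hsymm x w, hux, hwx] using h'
    · intro h
      have hx : x ∈ LinearMap.ker φ := by
        rw [hmem, hsymm u, hsymm w, h]
        simp
      exact ⟨hx, by ext y; exact LinearMap.congr_fun h y⟩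
  have key := ih (finrank (ZMod 2) (LinearMap.ker φ)) (by omega)
    (X.domRestrict₁₂ (LinearMap.ker φ) (LinearMap.ker φ)) (fun x => hX x) rfl
  rw [← Submodule.finrank_map_subtype_eq, hker] at key
  rw [← hdim]
  grind

/-- `IsWallRep B q X A g` presents `g` through a nonsingular bilinear form `X` on `E` refining
`q ∘ A`: `g v = v + A y` with `y` determined by `X y z = B v (A z)`. -/
structure IsWallRep {V E : Type*} [AddCommGroup V] [Module (ZMod 2) V] [AddCommGroup E]
    [Module (ZMod 2) E] (B : V →ₗ[ZMod 2] V →ₗ[ZMod 2] ZMod 2) (q : V → ZMod 2)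
    (X : E →ₗ[ZMod 2] E →ₗ[ZMod 2] ZMod 2) (A : E →ₗ[ZMod 2] V) (g : V →ₗ[ZMod 2] V) :
    Prop where
  injective : ∀ y, (∀ z, X y z = 0) → y = 0
  diag : ∀ y, X y y = q (A y)
  exists_eq : ∀ v, ∃ y, g v = v + A y ∧ ∀ z, X y z = B v (A z)

section

variable {V E : Type*} [AddCommGroup V] [Module (ZMod 2) V] [AddCommGroup E] [Module (ZMod 2) E]
  {B : V →ₗ[ZMod 2] V →ₗ[ZMod 2] ZMod 2} {q : V → ZMod 2}

theorem quadratic_zero (hq : ∀ u w, q (u + w) + q u + q w = B u w) : q 0 = 0 := by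
  have h := hq 0 0
  simp only [add_zero, map_zero, CharTwo.add_self_eq_zero, zero_add] at h
  exact h

theorem bilin_symm_of_quadratic (hq : ∀ u w, q (u + w) + q u + q w = B u w) (u w : V) :
    B u w = B w u := by
  rw [← hq, ← hq, add_comm u w]
  ring

theorem surjective_of_separating [FiniteDimensional (ZMod 2) V]
    (hB : ∀ v, (∀ w, B v w = 0) → v = 0) : Function.Surjective B := by
  have hinj : Function.Injective B := by
    rw [← LinearMap.ker_eq_bot, LinearMap.ker_eq_bot']
    exact fun v hv => hB v fun w => by simp [hv]
  exact (LinearMap.injective_iff_surjective_of_finrank_eq_finrank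
    (Subspace.dual_finrank_eq (K := ZMod 2) (V := V)).symm).1 hinj

theorem IsWallRep.even_finrank_range_add [FiniteDimensional (ZMod 2) V]
    [FiniteDimensional (ZMod 2) E] (hB : ∀ v, (∀ w, B v w = 0) → v = 0) (hq0 : q 0 = 0)
    {X : E →ₗ[ZMod 2] E →ₗ[ZMod 2] ZMod 2} {A : E →ₗ[ZMod 2] V} {g : V →ₗ[ZMod 2] V}
    (h : IsWallRep B q X A g) :
    Even (finrank (ZMod 2) (LinearMap.range (g - LinearMap.id)) + finrank (ZMod 2) E) := by
  set K := LinearMap.ker A with hK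
  set P : Submodule (ZMod 2) E := K.dualAnnihilator.comap X with hP
  have hXinj : Function.Injective X := by
    rw [← LinearMap.ker_eq_bot, LinearMap.ker_eq_bot']
    exact fun v hv => h.injective v fun w => by simp [hv]
  have hXsurj := surjective_of_separating h.injective
  have hmemP (y : E) : y ∈ P ↔ ∀ k ∈ K, X y k = 0 := by
    simp [hP, Submodule.mem_dualAnnihilator]
  have hrange : LinearMap.range (g - LinearMap.id) = LinearMap.range (A.domRestrict P) := by
    ext v
    constructor
    · rintro ⟨v, rfl⟩
      obtain ⟨y, hy, hyX⟩ := h.exists_eq v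
      refine ⟨⟨y, (hmemP y).2 fun k hk => ?_⟩, ?_⟩
      · rw [hyX, LinearMap.mem_ker.1 hk, map_zero]
      · simp [hy]
    · rintro ⟨⟨y, hyP⟩, rfl⟩
      have : X y ∈ LinearMap.range A.dualMap := by
        rw [LinearMap.range_dualMap_eq_dualAnnihilator_ker]
        exact hyP
      obtain ⟨ψ, hψ⟩ := this
      obtain ⟨v, rfl⟩ := surjective_of_separating hB ψ
      obtain ⟨y', hy', hyX⟩ := h.exists_eq v
      have : y' = y := hXinj (by rw [← hψ]; ext z; simp [hyX])
      subst this
      exact ⟨v, by simp [hy']⟩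
  have hPdim : finrank (ZMod 2) P = finrank (ZMod 2) K.dualAnnihilator :=
    (LinearEquiv.ofSubmodule' (LinearEquiv.ofBijective X ⟨hXinj, hXsurj⟩)
      K.dualAnnihilator).finrank_eq
  have hKdim := Subspace.finrank_add_finrank_dualAnnihilator_eq K
  have hker : (LinearMap.ker (A.domRestrict P)).map P.subtype
      = (LinearMap.ker (X.domRestrict₁₂ K K)).map K.subtype := by
    ext x
    simp only [Submodule.mem_map, LinearMap.mem_ker, Submodule.subtype_apply, Subtype.exists,
      exists_and_right, exists_eq_right]
    constructor
    · rintro ⟨hxP, hx⟩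
      exact ⟨hx, by ext k; exact (hmemP x).1 hxP k k.2⟩
    · rintro ⟨hxK, hx⟩
      exact ⟨(hmemP x).2 fun k hk => LinearMap.congr_fun hx ⟨k, hk⟩, hxK⟩
  have hkerdim : finrank (ZMod 2) (LinearMap.ker (A.domRestrict P))
      = finrank (ZMod 2) (LinearMap.ker (X.domRestrict₁₂ K K)) := by
    rw [← Submodule.finrank_map_subtype_eq, hker, Submodule.finrank_map_subtype_eq]
  have hdim := LinearMap.finrank_range_add_finrank_ker (A.domRestrict P)
  have heven := even_finrank_add_finrank_ker_of_isAlt (X.domRestrict₁₂ K K) fun k => by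
    have hk : A k = 0 := k.2
    change X k k = 0
    rw [h.diag, hk, hq0]
  rw [hrange]
  grind

theorem IsWallRep.comp {E₁ E₂ : Type*} [AddCommGroup E₁] [Module (ZMod 2) E₁]
    [AddCommGroup E₂] [Module (ZMod 2) E₂]
    (hq : ∀ u w, q (u + w) + q u + q w = B u w)
    {X₁ : E₁ →ₗ[ZMod 2] E₁ →ₗ[ZMod 2] ZMod 2} {A₁ : E₁ →ₗ[ZMod 2] V}
    {X₂ : E₂ →ₗ[ZMod 2] E₂ →ₗ[ZMod 2] ZMod 2} {A₂ : E₂ →ₗ[ZMod 2] V}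
    {g₁ g₂ : V →ₗ[ZMod 2] V} (h₁ : IsWallRep B q X₁ A₁ g₁) (h₂ : IsWallRep B q X₂ A₂ g₂) :
    IsWallRep B q
      (X₁.compl₁₂ (LinearMap.fst _ E₁ E₂) (LinearMap.fst _ E₁ E₂)
        + X₂.compl₁₂ (LinearMap.snd _ E₁ E₂) (LinearMap.snd _ E₁ E₂)
        + B.compl₁₂ (A₂ ∘ₗ LinearMap.snd _ E₁ E₂) (A₁ ∘ₗ LinearMap.fst _ E₁ E₂))
      (A₁.coprod A₂) (g₁ ∘ₗ g₂) where
  injective := by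
    rintro ⟨y₁, y₂⟩ hy
    obtain rfl : y₂ = 0 := h₂.injective _ fun z => by simpa using hy (0, z)
    obtain rfl : y₁ = 0 := h₁.injective _ fun z => by simpa using hy (z, 0)
    rfl
  diag := by
    rintro ⟨y₁, y₂⟩
    have h := hq (A₂ y₂) (A₁ y₁)
    simp only [LinearMap.add_apply, LinearMap.compl₁₂_apply, LinearMap.fst_apply,
      LinearMap.snd_apply, LinearMap.comp_apply, LinearMap.coprod_apply, h₁.diag, h₂.diag, ← h]
    rw [add_comm (A₁ y₁)]
    grind [CharTwo.two_eq_zero (R := ZMod 2)]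
  exists_eq v := by
    obtain ⟨y₂, hy₂, hX₂⟩ := h₂.exists_eq v
    obtain ⟨y₁, hy₁, hX₁⟩ := h₁.exists_eq (g₂ v)
    refine ⟨(y₁, y₂), ?_, ?_⟩
    · simp only [LinearMap.comp_apply, hy₁, LinearMap.coprod_apply]
      rw [hy₂]
      abel
    · rintro ⟨z₁, z₂⟩
      simp only [LinearMap.add_apply, LinearMap.compl₁₂_apply, LinearMap.fst_apply,
        LinearMap.snd_apply, LinearMap.comp_apply, LinearMap.coprod_apply, hX₁, hX₂, hy₂, map_add]
      grind [CharTwo.two_eq_zero (R := ZMod 2)]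

theorem exists_isWallRep [FiniteDimensional (ZMod 2) V] (hB : ∀ v, (∀ w, B v w = 0) → v = 0)
    (hq : ∀ u w, q (u + w) + q u + q w = B u w) {g : V →ₗ[ZMod 2] V}
    (hg : ∀ v, q (g v) = q v) :
    ∃ X, IsWallRep B q X (LinearMap.range (g - LinearMap.id)).subtype g := by
  have hsymm := bilin_symm_of_quadratic hq
  have hgB (u w : V) : B (g u) (g w) = B u w := by
    rw [← hq, ← hq, ← map_add, hg, hg, hg]
  obtain ⟨s, hs⟩ := LinearMap.exists_rightInverse_of_surjective
    (g - LinearMap.id).rangeRestrict (LinearMap.range_rangeRestrict _)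
  have hs' (y : LinearMap.range (g - LinearMap.id)) : g (s y) - s y = y :=
    congrArg Subtype.val (LinearMap.congr_fun hs y)
  have hfix (v : V) (hv : g v = v) (z : LinearMap.range (g - LinearMap.id)) : B v z = 0 := by
    obtain ⟨_, w, rfl⟩ := z
    have := hgB v w
    rw [hv] at this
    simp [this]
  have hXv (v : V) (z : LinearMap.range (g - LinearMap.id)) :
      B (s ((g - LinearMap.id).rangeRestrict v)) z = B v z := by
    have h := hfix (s ((g - LinearMap.id).rangeRestrict v) - v) (by
      have : g (s ((g - LinearMap.id).rangeRestrict v)) - s ((g - LinearMap.id).rangeRestrict v)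
          = g v - v := hs' _
      rw [map_sub, sub_eq_sub_iff_sub_eq_sub, this]) z
    rwa [map_sub, LinearMap.sub_apply, sub_eq_zero] at h
  set X := B.compl₁₂ s (LinearMap.range (g - LinearMap.id)).subtype with hX
  have hflip : ∀ z, (∀ y, X.flip z y = 0) → z = 0 := by
    intro z hz
    refine Subtype.ext (hB _ fun v => ?_)
    rw [hsymm, ← hXv]
    exact hz _
  have hXinj : ∀ y, (∀ z, X y z = 0) → y = 0 := by
    intro y hy
    refine (Module.forall_dual_apply_eq_zero_iff (ZMod 2) y).1 fun φ => ?_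
    obtain ⟨z, rfl⟩ := surjective_of_separating hflip φ
    exact hy z
  refine ⟨X, hXinj, fun y => ?_, fun v => ⟨(g - LinearMap.id).rangeRestrict v, by simp, hXv v⟩⟩
  have h := hq (s y) (y : V)
  have h' : s y + (y : V) = g (s y) := by rw [← hs' y]; abel
  rw [h', hg] at h
  change B (s y) y = q y
  grind [CharTwo.two_eq_zero (R := ZMod 2)]

/-- The Dickson invariant is multiplicative. -/
theorem finrank_range_comp_sub_id [FiniteDimensional (ZMod 2) V]
    (hB : ∀ v, (∀ w, B v w = 0) → v = 0) (hq : ∀ u w, q (u + w) + q u + q w = B u w)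
    {g₁ g₂ : V →ₗ[ZMod 2] V} (h₁ : ∀ v, q (g₁ v) = q v) (h₂ : ∀ v, q (g₂ v) = q v) :
    (finrank (ZMod 2) (LinearMap.range (g₁ ∘ₗ g₂ - LinearMap.id)) : ZMod 2)
      = finrank (ZMod 2) (LinearMap.range (g₁ - LinearMap.id))
        + finrank (ZMod 2) (LinearMap.range (g₂ - LinearMap.id)) := by
  obtain ⟨X₁, hX₁⟩ := exists_isWallRep hB hq h₁
  obtain ⟨X₂, hX₂⟩ := exists_isWallRep hB hq h₂
  have h := (hX₁.comp hq hX₂).even_finrank_range_add hB (quadratic_zero hq)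
  rw [finrank_prod, ← ZMod.natCast_eq_zero_iff_even, Nat.cast_add, Nat.cast_add] at h
  exact CharTwo.add_eq_zero.mp h

end

section

variable {V : Type*} [AddCommGroup V] [Module (ZMod 2) V]
  {B : V →ₗ[ZMod 2] V →ₗ[ZMod 2] ZMod 2} {q : V → ZMod 2}

/-- The sign `(-1)^x` of a residue modulo two. -/
def signZModTwo (x : ZMod 2) : ℤ := if x = 0 then 1 else -1

theorem signZModTwo_add (x y : ZMod 2) :
    signZModTwo (x + y) = signZModTwo x * signZModTwo y := by
  revert x y
  decide

theorem exists_apply_eq_one_of_separating (hB : ∀ v, (∀ w, B v w = 0) → v = 0) {v : V}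
    (hv : v ≠ 0) : ∃ w, B v w = 1 := by
  by_contra! h
  exact hv (hB v fun w => by_contra fun h0 => h w (Fin.eq_one_of_ne_zero _ h0))

theorem sum_signZModTwo_bilin_eq_zero [Fintype V] (hB : ∀ v, (∀ w, B v w = 0) → v = 0)
    {v : V} (hv : v ≠ 0) : ∑ w, signZModTwo (B v w) = 0 := by
  obtain ⟨u, hu⟩ := exists_apply_eq_one_of_separating hB hv
  have h := Equiv.sum_comp (Equiv.addRight u) fun w => signZModTwo (B v w)
  simp only [Equiv.coe_addRight, map_add, hu, signZModTwo_add, ← Finset.sum_mul] at h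
  have h1 : signZModTwo 1 = -1 := rfl
  rw [h1] at h
  linarith

theorem sum_signZModTwo_quadratic_ne_zero [Fintype V] (hB : ∀ v, (∀ w, B v w = 0) → v = 0)
    (hq : ∀ u w, q (u + w) + q u + q w = B u w) : ∑ w, signZModTwo (q w) ≠ 0 := by
  have hq0 := quadratic_zero hq
  have hsq : (∑ w, signZModTwo (q w)) * ∑ w, signZModTwo (q w) = Fintype.card V := by
    calc
      _ = ∑ u, ∑ d, signZModTwo (q u) * signZModTwo (q (d + u)) := by
        rw [Finset.sum_mul_sum]
        refine Finset.sum_congr rfl fun u _ => ?_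
        exact (Equiv.sum_comp (Equiv.addRight u)
          fun w => signZModTwo (q u) * signZModTwo (q w)).symm
      _ = ∑ d, ∑ u, signZModTwo (q d) * signZModTwo (B d u) := by
        rw [Finset.sum_comm]
        refine Finset.sum_congr rfl fun d _ => Finset.sum_congr rfl fun u _ => ?_
        rw [← signZModTwo_add, ← signZModTwo_add, ← hq]
        congr 1
        grind [CharTwo.two_eq_zero (R := ZMod 2)]
      _ = ∑ u, signZModTwo (q 0) * signZModTwo (B 0 u) := by
        refine Finset.sum_eq_single 0 (fun d _ hd => ?_) (by simp)
        rw [← Finset.mul_sum, sum_signZModTwo_bilin_eq_zero hB hd, mul_zero]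
      _ = Fintype.card V := by simp [hq0, signZModTwo]
  intro h
  rw [h, mul_zero] at hsq
  exact Fintype.card_ne_zero (Nat.cast_eq_zero.1 hsq.symm)

/-- If `q + B(·, c)` is isometric to `q`, then `c` is singular (equality of Arf invariants). -/
theorem quadratic_eq_zero_of_bilin_eq [Finite V] (hB : ∀ v, (∀ w, B v w = 0) → v = 0)
    (hq : ∀ u w, q (u + w) + q u + q w = B u w) (e : V ≃ V) {c : V}
    (hc : ∀ w, B w c = q (e w) + q w) : q c = 0 := by
  have := Fintype.ofFinite V
  have h₁ := Equiv.sum_comp e fun w => signZModTwo (q w)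
  have h₂ := Equiv.sum_comp (Equiv.addRight c) fun w => signZModTwo (q w)
  have h₃ (w : V) : q (w + c) = q (e w) + q c := by
    have h := hq w c
    rw [hc] at h
    grind [CharTwo.two_eq_zero (R := ZMod 2)]
  simp only [Equiv.coe_addRight, h₃, signZModTwo_add, ← Finset.sum_mul] at h₂
  rw [h₁] at h₂
  have h := mul_left_cancel₀ (sum_signZModTwo_quadratic_ne_zero hB hq) (h₂.trans (mul_one _).symm)
  by_contra hqc
  simp [signZModTwo, hqc] at h

/-- The symplectic transvection `x ↦ x + B(v, x) v`. -/
def sympTransvection (hAlt : ∀ v, B v v = 0) (v : V) : V ≃ₗ[ZMod 2] V :=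
  LinearEquiv.transvection (f := B v) (hAlt v)

theorem sympTransvection_apply (hAlt : ∀ v, B v v = 0) (v x : V) :
    sympTransvection hAlt v x = x + B v x • v := rfl

/-- A homomorphism from the symplectic group to `ZMod 2` vanishing on the orthogonal group is
zero. -/
theorem eq_zero_of_orthogonal_eq_zero [Finite V] (hAlt : ∀ v, B v v = 0)
    (hB : ∀ v, (∀ w, B v w = 0) → v = 0)
    (hq : ∀ u w, q (u + w) + q u + q w = B u w) (h : SympGrp B → ZMod 2)
    (hmul : ∀ σ τ ρ : SympGrp B, ρ.1 = τ.1.trans σ.1 → h ρ = h σ + h τ)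
    (hO : ∀ σ : SympGrp B, (∀ x, q (σ.1 x) = q x) → h σ = 0) (σ : SympGrp B) {c : V}
    (hc : ∀ w, B w c = q (σ.1.symm w) + q w) : h σ = 0 := by
  have hsymm := bilin_symm_of_quadratic hq
  have hT (v u w : V) : B (sympTransvection hAlt v u) (sympTransvection hAlt v w) = B u w := by
    simp only [sympTransvection_apply, map_add, map_smul, LinearMap.add_apply,
      LinearMap.smul_apply, smul_eq_mul, hAlt, hsymm u v]
    grind [CharTwo.two_eq_zero (R := ZMod 2)]
  let T (v : V) : SympGrp B := ⟨sympTransvection hAlt v, hT v⟩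
  have hqT (v w : V) : q (sympTransvection hAlt v w) = q w + B v w * (q v + 1) := by
    rw [sympTransvection_apply]
    rcases eq_or_ne (B v w) 0 with h0 | h0
    · simp [h0]
    · have h1 : B v w = 1 := Fin.eq_one_of_ne_zero _ h0
      have h2 := hq v w
      rw [h1, add_comm v w] at h2
      rw [h1, one_smul, one_mul]
      grind [CharTwo.two_eq_zero (R := ZMod 2)]
  have hTone (v : V) (hv : q v = 1) : h (T v) = 0 := by
    refine hO _ fun x => ?_
    change q (sympTransvection hAlt v x) = q x
    rw [hqT, hv, CharTwo.add_self_eq_zero, mul_zero, add_zero]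
  have hqc : q c = 0 := quadratic_eq_zero_of_bilin_eq hB hq σ.1.symm.toEquiv hc
  have hTσ : h (T c) + h σ = 0 := by
    let ρ : SympGrp B := ⟨σ.1.trans (T c).1, fun u w => ((hT c _ _).trans (σ.2 u w))⟩
    rw [← hmul (T c) σ ρ rfl]
    refine hO _ fun x => ?_
    change q (sympTransvection hAlt c (σ.1 x)) = q x
    rw [hqT, hqc, hsymm, hc, LinearEquiv.symm_apply_apply]
    grind [CharTwo.two_eq_zero (R := ZMod 2)]
  suffices hTc : h (T c) = 0 by rwa [hTc, zero_add] at hTσ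
  rcases eq_or_ne c 0 with rfl | hc0
  · refine hO _ fun x => ?_
    change q (sympTransvection hAlt 0 x) = q x
    simp [sympTransvection_apply]
  obtain ⟨w, hcw, hqw⟩ : ∃ w, B c w = 1 ∧ q w = 0 := by
    obtain ⟨w, hcw⟩ := exists_apply_eq_one_of_separating hB hc0
    rcases eq_or_ne (q w) 0 with h0 | h0
    · exact ⟨w, hcw, h0⟩
    · refine ⟨c + w, by simp [hAlt, hcw], ?_⟩
      have h1 : q w = 1 := Fin.eq_one_of_ne_zero _ h0
      have h2 := hq c w
      rw [hcw, h1, hqc] at h2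
      grind [CharTwo.two_eq_zero (R := ZMod 2)]
  have hqcw : q (c + w) = 1 := by
    have h2 := hq c w
    rw [hcw, hqw, hqc] at h2
    grind
  let ρ : SympGrp B := ⟨(T c).1.trans (T w).1, fun u x => (hT w _ _).trans (hT c _ _)⟩
  have h₁ := hmul (T w) (T c) ρ rfl
  have h₂ := hmul (T (c + w)) (T w) ρ <| by
    ext x
    change sympTransvection hAlt w (sympTransvection hAlt c x)
      = sympTransvection hAlt (c + w) (sympTransvection hAlt w x)
    simp only [sympTransvection_apply, map_add, map_smul, LinearMap.add_apply, hAlt,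
      hsymm w c, hcw]
    match_scalars <;> grind [CharTwo.two_eq_zero (R := ZMod 2)]
  rw [hTone _ hqcw] at h₂
  grind

/-- The orthogonal sum of `B` with a hyperbolic plane. -/
def hyperbolicExt (B : V →ₗ[ZMod 2] V →ₗ[ZMod 2] ZMod 2) :
    (V × ZMod 2 × ZMod 2) →ₗ[ZMod 2] (V × ZMod 2 × ZMod 2) →ₗ[ZMod 2] ZMod 2 :=
  LinearMap.mk₂ (ZMod 2) (fun x y => B x.1 y.1 + x.2.1 * y.2.2 + x.2.2 * y.2.1)
    (fun x y z => by simp; ring) (fun r x y => by simp; ring)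
    (fun x y z => by simp; ring) (fun r x y => by simp; ring)

theorem hyperbolicExt_apply (x y : V × ZMod 2 × ZMod 2) :
    hyperbolicExt B x y = B x.1 y.1 + x.2.1 * y.2.2 + x.2.2 * y.2.1 := rfl

theorem hyperbolicExt_separating (hB : ∀ v, (∀ w, B v w = 0) → v = 0) (v : V × ZMod 2 × ZMod 2)
    (hv : ∀ w, hyperbolicExt B v w = 0) : v = 0 := by
  obtain ⟨v, a, b⟩ := v
  obtain rfl : v = 0 := hB v fun w => by simpa [hyperbolicExt_apply] using hv (w, 0, 0)
  obtain rfl : a = 0 := by simpa [hyperbolicExt_apply] using hv (0, 0, 1)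
  obtain rfl : b = 0 := by simpa [hyperbolicExt_apply] using hv (0, 1, 0)
  rfl

/-- The quadratic refinement of `hyperbolicExt B` taking the value `1` on `(0, 1, 0)`
and `0` on `(0, 0, 1)`. -/
def quadraticExt (q : V → ZMod 2) (x : V × ZMod 2 × ZMod 2) : ZMod 2 :=
  q x.1 + x.2.1 + x.2.1 * x.2.2

theorem quadraticExt_polar (hq : ∀ u w, q (u + w) + q u + q w = B u w)
    (u w : V × ZMod 2 × ZMod 2) :
    quadraticExt q (u + w) + quadraticExt q u + quadraticExt q w = hyperbolicExt B u w := by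
  simp only [quadraticExt, hyperbolicExt_apply, ← hq, Prod.fst_add, Prod.snd_add]
  grind [CharTwo.two_eq_zero (R := ZMod 2)]

/-- The extension of `σ` fixing `(0, 1, 0)` and sending `(0, 0, 1)` to `(u, 0, 1)`. -/
def isometryExt (B : V →ₗ[ZMod 2] V →ₗ[ZMod 2] ZMod 2) (σ : V →ₗ[ZMod 2] V) (u : V) :
    (V × ZMod 2 × ZMod 2) →ₗ[ZMod 2] (V × ZMod 2 × ZMod 2) where
  toFun x := (σ x.1 + x.2.2 • u, x.2.1 + B (σ x.1) u, x.2.2)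
  map_add' x y := by
    ext
    · simp [add_smul]; abel
    · simp; abel
    · simp
  map_smul' r x := by ext <;> simp [mul_smul, mul_add]

theorem isometryExt_apply (σ : V →ₗ[ZMod 2] V) (u : V) (x : V × ZMod 2 × ZMod 2) :
    isometryExt B σ u x = (σ x.1 + x.2.2 • u, x.2.1 + B (σ x.1) u, x.2.2) := rfl

theorem quadraticExt_isometryExt (hq : ∀ u w, q (u + w) + q u + q w = B u w)
    {σ : V →ₗ[ZMod 2] V} {u : V} (hu : q u = 0) (hσ : ∀ v, B (σ v) u = q v + q (σ v))
    (x : V × ZMod 2 × ZMod 2) : quadraticExt q (isometryExt B σ u x) = quadraticExt q x := by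
  obtain ⟨v, a, b⟩ := x
  have h₁ := hσ v
  have h₂ := hq (σ v) u
  simp only [quadraticExt, isometryExt_apply]
  obtain rfl | rfl : b = 0 ∨ b = 1 := by revert b; decide
  · simp only [zero_smul, add_zero, mul_zero, h₁]
    grind [CharTwo.two_eq_zero (R := ZMod 2)]
  · simp only [one_smul, mul_one]
    grind [CharTwo.two_eq_zero (R := ZMod 2)]

/-- The transvection along `(0, 1, 0)`, raised to the power `t`. -/
def planeShear (V : Type*) [AddCommGroup V] [Module (ZMod 2) V] (t : ZMod 2) :
    (V × ZMod 2 × ZMod 2) →ₗ[ZMod 2] (V × ZMod 2 × ZMod 2) where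
  toFun x := (x.1, x.2.1 + t * x.2.2, x.2.2)
  map_add' x y := by
    ext
    · simp
    · simp; ring
    · simp
  map_smul' r x := by ext <;> simp; ring

theorem planeShear_apply (t : ZMod 2) (x : V × ZMod 2 × ZMod 2) :
    planeShear V t x = (x.1, x.2.1 + t * x.2.2, x.2.2) := rfl

theorem quadraticExt_planeShear (t : ZMod 2) (x : V × ZMod 2 × ZMod 2) :
    quadraticExt q (planeShear V t x) = quadraticExt q x := by
  obtain ⟨v, a, b⟩ := x
  simp only [quadraticExt, planeShear_apply]
  have h : t * b + t * b * b = 0 := by revert t b; decide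
  linear_combination h

theorem finrank_range_planeShear_sub_id (t : ZMod 2) :
    (finrank (ZMod 2) (LinearMap.range (planeShear V t - LinearMap.id)) : ZMod 2) = t := by
  obtain rfl | rfl : t = 0 ∨ t = 1 := by revert t; decide
  · have : planeShear V 0 - LinearMap.id = 0 := by
      ext x <;> simp [planeShear_apply]
    rw [this, LinearMap.range_zero, finrank_bot, Nat.cast_zero]
  · have : LinearMap.range (planeShear V 1 - LinearMap.id)
        = Submodule.span (ZMod 2) {((0, 1, 0) : V × ZMod 2 × ZMod 2)} := by
      ext x
      rw [Submodule.mem_span_singleton]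
      constructor
      · rintro ⟨y, rfl⟩
        exact ⟨y.2.2, by simp [planeShear_apply, Prod.ext_iff]⟩
      · rintro ⟨b, rfl⟩
        exact ⟨(0, 0, b), by simp [planeShear_apply]⟩
    rw [this, finrank_span_singleton (by simp), Nat.cast_one]

theorem isometryExt_comp (σ τ : V →ₗ[ZMod 2] V) (hσ : ∀ u w, B (σ u) (σ w) = B u w) (s t : V) :
    isometryExt B σ s ∘ₗ isometryExt B τ t
      = planeShear V (B (σ t) s) ∘ₗ isometryExt B (σ ∘ₗ τ) (s + σ t) := by
  refine LinearMap.ext fun x => ?_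
  simp only [LinearMap.comp_apply, isometryExt_apply, planeShear_apply, map_add, map_smul,
    smul_add, LinearMap.add_apply, LinearMap.smul_apply, smul_eq_mul, hσ, Prod.mk.injEq]
  refine ⟨by abel, by ring, trivial⟩

theorem finrank_range_isometryExt_zero_sub_id (σ : V →ₗ[ZMod 2] V) :
    finrank (ZMod 2) (LinearMap.range (isometryExt B σ 0 - LinearMap.id))
      = finrank (ZMod 2) (LinearMap.range (σ - LinearMap.id)) := by
  have h : isometryExt B σ 0 - LinearMap.id
      = LinearMap.inl (ZMod 2) V (ZMod 2 × ZMod 2) ∘ₗ (σ - LinearMap.id)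
        ∘ₗ LinearMap.fst (ZMod 2) V (ZMod 2 × ZMod 2) := by
    refine LinearMap.ext fun x => ?_
    simp [isometryExt_apply, Prod.ext_iff]
  rw [h, LinearMap.range_comp, LinearMap.range_comp_of_range_eq_top _
    (LinearMap.range_eq_top.2 LinearMap.fst_surjective)]
  exact (Submodule.equivMapOfInjective _ LinearMap.inl_injective _).finrank_eq.symm

end

/-- there is a unique function `f_q : Sp(V) → F₂` whose coboundary is the
cup-product cocycle `c_q ∪ c_q` and which restricts on `O(q)` to
`σ ↦ dim_{F₂} V^σ (mod 2)`.  In particular `c ∪ c` is trivial in `H²(Sp(V), F₂)`. -/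
theorem stmt0 (V : Type*) [AddCommGroup V] [Module (ZMod 2) V]
    [FiniteDimensional (ZMod 2) V]
    (B : V →ₗ[ZMod 2] V →ₗ[ZMod 2] ZMod 2)
    (hAlt : ∀ v : V, B v v = 0)
    (hNondeg : ∀ v : V, (∀ w : V, B v w = 0) → v = 0)
    (q : V → ZMod 2)
    (hq : ∀ u w : V, q (u + w) + q u + q w = B u w)
    (c : (V ≃ₗ[ZMod 2] V) → V)
    (hc : ∀ σ : V ≃ₗ[ZMod 2] V, (∀ u w, B (σ u) (σ w) = B u w) →
      ∀ w : V, B w (c σ) = q (σ.symm w) + q w) :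
    ∃! f : SympGrp B → ZMod 2,
      (∀ σ τ ρ : SympGrp B, ρ.1 = τ.1.trans σ.1 →
        f ρ + f σ + f τ = B (c σ.1) (σ.1 (c τ.1))) ∧
      (∀ σ : SympGrp B, (∀ x : V, q (σ.1 x) = q x) →
        f σ = (fixedRank σ.1 : ZMod 2)) := by
  have : Finite V := Module.finite_of_finite (ZMod 2)
  have hsymm := bilin_symm_of_quadratic hq
  have hcsymm (σ : SympGrp B) (v : V) : B (σ.1 v) (c σ.1) = q v + q (σ.1 v) := by
    rw [hc _ σ.2, LinearEquiv.symm_apply_apply]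
  have hext (u v : V) (h : ∀ w, B w u = B w v) : u = v := by
    refine sub_eq_zero.1 (hNondeg _ fun w => ?_)
    rw [hsymm, map_sub, h, sub_self]
  have hqc (σ : SympGrp B) : q (c σ.1) = 0 :=
    quadratic_eq_zero_of_bilin_eq hNondeg hq σ.1.symm.toEquiv (hc _ σ.2)
  have hExt (σ : SympGrp B) := quadraticExt_isometryExt hq (hqc σ) (hcsymm σ)
  refine existsUnique_of_exists_of_unique ⟨fun σ => finrank (ZMod 2)
    (LinearMap.range (isometryExt B σ.1.toLinearMap (c σ.1) - LinearMap.id)), ?_, ?_⟩ ?_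
  · intro σ τ ρ hρ
    have hcρ : c ρ.1 = c σ.1 + σ.1 (c τ.1) := by
      refine hext _ _ fun w => ?_
      obtain ⟨w, rfl⟩ := ρ.1.surjective w
      have h₁ := hcsymm τ w
      have h₂ := hcsymm σ (τ.1 w)
      rw [hcsymm ρ, map_add, hρ, LinearEquiv.trans_apply, σ.2, h₁, h₂]
      grind [CharTwo.two_eq_zero (R := ZMod 2)]
    have hcomp := isometryExt_comp (B := B) σ.1.toLinearMap τ.1.toLinearMap σ.2 (c σ.1) (c τ.1)
    have hρ' : σ.1.toLinearMap ∘ₗ τ.1.toLinearMap = ρ.1.toLinearMap := by rw [hρ]; rfl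
    rw [hρ', LinearEquiv.coe_coe, ← hcρ] at hcomp
    have hB' := hyperbolicExt_separating hNondeg
    have hq' := quadraticExt_polar hq
    have h₁ := finrank_range_comp_sub_id hB' hq' (hExt σ) (hExt τ)
    rw [hcomp, finrank_range_comp_sub_id hB' hq' (quadraticExt_planeShear _) (hExt ρ),
      finrank_range_planeShear_sub_id, hsymm] at h₁
    grind [CharTwo.two_eq_zero (R := ZMod 2)]
  · intro σ hσ
    have hc0 : c σ.1 = 0 := hext _ _ fun w => by
      obtain ⟨w, rfl⟩ := σ.1.surjective w
      rw [hcsymm, hσ, CharTwo.add_self_eq_zero, map_zero]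
    have hker : LinearMap.ker B = ⊥ := by
      rw [LinearMap.ker_eq_bot']
      exact fun v hv => hNondeg v fun w => by simp [hv]
    have heven := even_finrank_add_finrank_ker_of_isAlt B hAlt
    rw [hker, finrank_bot, add_zero, ← LinearMap.finrank_range_add_finrank_ker
      (σ.1.toLinearMap - LinearMap.id), ← ZMod.natCast_eq_zero_iff_even, Nat.cast_add] at heven
    beta_reduce
    rw [hc0, finrank_range_isometryExt_zero_sub_id]
    exact CharTwo.add_eq_zero.mp heven
  · rintro f₁ f₂ ⟨hf₁, hO₁⟩ ⟨hf₂, hO₂⟩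
    funext σ
    refine CharTwo.add_eq_zero.mp (eq_zero_of_orthogonal_eq_zero hAlt hNondeg hq
      (fun σ => f₁ σ + f₂ σ) (fun σ τ ρ hρ => ?_) (fun σ hσ => ?_) σ (hc _ σ.2))
    · have h₁ := hf₁ σ τ ρ hρ
      have h₂ := hf₂ σ τ ρ hρ
      grind [CharTwo.two_eq_zero (R := ZMod 2)]
    · rw [hO₁ σ hσ, hO₂ σ hσ, CharTwo.add_self_eq_zero]
end

section
/- Let V be a finite-dimensional vector space over F₂ with a nondegenerate alternating bilinear form B, let q be a quadratic refinement of B, let v ∈ V, and let q' be the quadratic refinement q'(w) = q(w) + B(v,w). Then the associated 1-cocycles differ by the coboundary of v: for every σ ∈ Sp(V), c_{q'}(σ) = c_q(σ) + σ(v) + v. In particular, the class of c_q in H¹(Sp(V), V) is independent of the choice of quadratic refinement q. -/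
/-- if `q' = q + B(v,·)` then the associated 1-cocycles differ by the
coboundary of `v`: `c_{q'}(σ) = c_q(σ) + σ(v) + v` for every `σ ∈ Sp(V)`. -/
theorem stmt4 (V : Type*) [AddCommGroup V] [Module (ZMod 2) V]
    [FiniteDimensional (ZMod 2) V]
    (B : V →ₗ[ZMod 2] V →ₗ[ZMod 2] ZMod 2)
    (hAlt : ∀ v : V, B v v = 0)
    (hNondeg : ∀ v : V, (∀ w : V, B v w = 0) → v = 0)
    (q : V → ZMod 2)
    (hq : ∀ u w : V, q (u + w) + q u + q w = B u w)
    (v : V) :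
    ∀ σ : V ≃ₗ[ZMod 2] V, (∀ u w, B (σ u) (σ w) = B u w) →
      ∀ cq cq' : V,
        (∀ w : V, B w cq = q (σ.symm w) + q w) →
        (∀ w : V, B w cq' =
          (q (σ.symm w) + B v (σ.symm w)) + (q w + B v w)) →
        cq' = cq + σ v + v := by
  intro σ hσ cq cq' hcq hcq'
  have hsymm : ∀ u w : V, B u w = B w u := fun u w => by
    rw [← hq u w, ← hq w u, add_comm u w]
    ring
  refine sub_eq_zero.mp (hNondeg _ fun w => ?_)
  have hσv : B w (σ v) = B v (σ.symm w) := by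
    rw [hsymm v, ← hσ (σ.symm w), σ.apply_symm_apply]
  rw [hsymm, map_sub, map_add, map_add, hcq, hcq', hσv, hsymm w v]
  ring
end

section
/- Let V be a finite-dimensional vector space over F₂ with a nondegenerate alternating bilinear form B and let q be a quadratic refinement of B. Then the map O(q) → ℤ/2ℤ sending σ to dim_{F₂} V^σ (mod 2) is a group homomorphism; that is, for all σ, τ ∈ O(q) one has dim_{F₂} V^{στ} ≡ dim_{F₂} V^σ + dim_{F₂} V^τ (mod 2). -/
namespace LinearMap

open Module

variable {K V W : Type*} [Field K] [AddCommGroup V] [Module K V]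
  [AddCommGroup W] [Module K W]

/-- For an isometry `σ`, the fixed space of `σ` is the orthogonal complement of the range
of `σ - 1`. -/
theorem BilinForm.orthogonal_range_sub_id {B : LinearMap.BilinForm K V} (hB : B.Nondegenerate)
    (σ : V ≃ₗ[K] V) (hσ : ∀ u w, B (σ u) (σ w) = B u w) :
    B.orthogonal (range (σ.toLinearMap - LinearMap.id)) = ker (σ.toLinearMap - LinearMap.id) := by
  have key (u w : V) : B (σ u - u) w = B u (σ.symm w - w) := by
    rw [map_sub, LinearMap.sub_apply, map_sub]
    nth_rw 1 [← σ.apply_symm_apply w]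
    rw [hσ]
  ext w
  simp only [mem_orthogonal_iff, mem_range, forall_exists_index, forall_apply_eq_imp_iff,
    LinearMap.sub_apply, LinearEquiv.coe_coe, LinearMap.id_coe, id_eq, mem_ker, key, sub_eq_zero]
  constructor
  · intro h
    have := hB.2 (σ.symm w - w) h
    rw [sub_eq_zero, LinearEquiv.symm_apply_eq] at this
    exact this.symm
  · intro h u
    nth_rw 1 [← h]
    simp

variable [FiniteDimensional K V]

theorem finrank_map_add_finrank_inf_ker (f : V →ₗ[K] W) (S : Submodule K V) :
    finrank K (S.map f) + finrank K (S ⊓ ker f : Submodule K V) = finrank K S := by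
  have h := finrank_range_add_finrank_ker (f.domRestrict S)
  rwa [range_domRestrict, ker_domRestrict, ← Submodule.finrank_map_subtype_eq,
    Submodule.map_comap_subtype] at h

/-- Splitting off a hyperbolic plane from an alternating form does not change its kernel. -/
theorem IsAlt.exists_submodule_of_ne_zero {f : V →ₗ[K] V →ₗ[K] K} (hf : f.IsAlt) (h : f ≠ 0) :
    ∃ S : Submodule K V, finrank K S + 2 = finrank K V ∧
      finrank K (ker (f.domRestrict₁₂ S S)) = finrank K (ker f) := by
  obtain ⟨u, v, huv⟩ : ∃ u v, f u v ≠ 0 := by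
    by_contra! H
    exact h (LinearMap.ext₂ H)
  have hvu : f v u = -f u v := (hf.neg u v).symm
  set φ : V →ₗ[K] K × K := (f u).prod (f v) with hφ
  have surj (p : K × K) : φ ((p.1 / f u v) • v - (p.2 / f u v) • u) = p := by
    ext <;> simp [hφ, hvu, hf.self_eq_zero, huv]
  have mem_iff (x : V) : x ∈ ker φ ↔ f u x = 0 ∧ f v x = 0 := by simp [hφ]
  refine ⟨ker φ, ?_, ?_⟩
  · have h₁ := finrank_range_add_finrank_ker φ
    rw [range_eq_top.2 fun p => ⟨_, surj p⟩, finrank_top, finrank_prod, finrank_self] at h₁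
    omega
  · rw [← Submodule.finrank_map_subtype_eq]
    refine congrArg (fun S : Submodule K V => finrank K S) (Submodule.ext fun x => ?_)
    simp only [Submodule.mem_map, mem_ker, Submodule.subtype_apply]
    constructor
    · rintro ⟨⟨x, hx⟩, h₁, rfl⟩
      ext y
      have hy : y - ((f u y / f u v) • v - (f v y / f u v) • u) ∈ ker φ := by
        rw [mem_ker, map_sub, sub_eq_zero]
        exact (surj (φ y)).symm
      have h₂ : f x (y - ((f u y / f u v) • v - (f v y / f u v) • u)) = 0 :=
        LinearMap.congr_fun h₁ ⟨_, hy⟩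
      obtain ⟨hux, hvx⟩ := (mem_iff x).1 hx
      simpa [hf.eq_iff.1 hux, hf.eq_iff.1 hvx] using h₂
    · intro hx
      have hx' (y : V) : f x y = 0 := by rw [hx, zero_apply]
      exact ⟨⟨x, (mem_iff x).2 ⟨hf.eq_iff.1 (hx' u), hf.eq_iff.1 (hx' v)⟩⟩,
        LinearMap.ext fun y => hx' y, rfl⟩

/-- An alternating bilinear form has even rank. -/
theorem IsAlt.even_finrank_add_finrank_ker {f : V →ₗ[K] V →ₗ[K] K} (hf : f.IsAlt) :
    Even (finrank K V + finrank K (ker f)) := by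
  induction hn : finrank K V using Nat.strong_induction_on generalizing V with
  | _ n ih =>
    by_cases h : f = 0
    · rw [h, ker_zero, finrank_top, hn]
      exact Even.add_self n
    · obtain ⟨S, hS, hker⟩ := hf.exists_submodule_of_ne_zero h
      have := ih _ (by omega) (f := f.domRestrict₁₂ S S) (fun x => hf x) rfl
      rw [hker] at this
      rw [← hn, ← hS, add_right_comm]
      exact this.add even_two

/-- The parity of the three fixed spaces, given that the Wall-type form
`((x, y), (x', y')) ↦ B x (τ y' - y')` is alternating on pairs with `σ x - x = σ (τ y) - y`. -/
theorem BilinForm.even_finrank_fixed {B : LinearMap.BilinForm K V} (hAlt : B.IsAlt)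
    (hB : B.Nondegenerate) (σ τ : V ≃ₗ[K] V) (hσ : ∀ u w, B (σ u) (σ w) = B u w)
    (hτ : ∀ u w, B (τ u) (τ w) = B u w)
    (h : ∀ x y, σ x - x = σ (τ y) - y → B x (τ y - y) = 0) :
    Even (finrank K (ker (σ.toLinearMap - LinearMap.id)) + finrank K (ker (τ.toLinearMap - LinearMap.id)) +
      finrank K (ker ((τ.trans σ).toLinearMap - LinearMap.id))) := by
  have hAltEven : Even (finrank K V) := by
    have h := IsAlt.even_finrank_add_finrank_ker hAlt
    rwa [hB.ker_eq_bot, finrank_bot, add_zero] at h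
  have orth_σ := orthogonal_range_sub_id hB σ hσ
  have orth_τ := orthogonal_range_sub_id hB τ hτ
  have orth (S : Submodule K V) : B.orthogonal (B.orthogonal S) = S :=
    orthogonal_orthogonal hB hAlt.isRefl S
  set a := σ.toLinearMap - LinearMap.id with ha
  set b := τ.toLinearMap - LinearMap.id with hb
  set c := (τ.trans σ).toLinearMap - LinearMap.id with hc'
  have hc (y : V) : c y = a (τ y) + b y := by simp [ha, hb, hc']
  have orth_sup (S T : Submodule K V) :
      B.orthogonal (S ⊔ T) = B.orthogonal S ⊓ B.orthogonal T := by
    refine le_antisymm (le_inf (orthogonal_le le_sup_left) (orthogonal_le le_sup_right)) ?_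
    rintro x ⟨hS, hT⟩ y hy
    obtain ⟨s, hs, t, ht, rfl⟩ := Submodule.mem_sup.1 hy
    have h₁ : B s x = 0 := hS s hs
    have h₂ : B t x = 0 := hT t ht
    change B (s + t) x = 0
    rw [map_add, LinearMap.add_apply, h₁, h₂, add_zero]
  have orth_inf : B.orthogonal (range a ⊓ range b) = ker a ⊔ ker b := by
    rw [← orth (ker a ⊔ ker b), orth_sup, ← orth_σ, ← orth_τ, orth, orth]
  set P : Submodule K (V × V) := ker (a.coprod (-c)) with hP
  have mem_P (x y : V) : (x, y) ∈ P ↔ a x = c y := by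
    simp [hP, ← sub_eq_add_neg, sub_eq_zero]
  have range_sup : range a ⊔ range c = range a ⊔ range b := by
    refine le_antisymm (sup_le le_sup_left ?_) (sup_le le_sup_left ?_)
    · rintro _ ⟨y, rfl⟩
      rw [hc]
      exact Submodule.add_mem_sup ⟨_, rfl⟩ ⟨_, rfl⟩
    · rintro _ ⟨y, rfl⟩
      rw [eq_sub_of_add_eq' (hc y).symm, sub_eq_neg_add, ← map_neg]
      exact Submodule.add_mem_sup ⟨_, rfl⟩ ⟨_, rfl⟩
  have finrank_P : finrank K P = finrank K V + finrank K (ker a ⊓ ker b : Submodule K V) := by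
    have h₁ := finrank_range_add_finrank_ker (a.coprod (-c))
    rw [range_coprod, range_neg, range_sup, finrank_prod, ← hP] at h₁
    have h₂ := finrank_orthogonal hB (range a ⊔ range b)
    rw [orth_sup, orth_σ, orth_τ] at h₂
    have h₃ := Submodule.finrank_le (range a ⊔ range b)
    omega
  set ω : V × V →ₗ[K] V × V →ₗ[K] K := B.compl₁₂ (fst K V V) (b ∘ₗ snd K V V) with hω
  have ω_alt : (ω.domRestrict₁₂ P P).IsAlt := by
    rintro ⟨⟨x, y⟩, hxy⟩
    exact h x y ((mem_P x y).1 hxy)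
  set R : Submodule K (V × V) := P ⊓ (ker a ⊔ ker b).comap (fst K V V) with hR
  have ker_ω : (ker (ω.domRestrict₁₂ P P)).map P.subtype = R := by
    ext ⟨x, y⟩
    have : (x, y) ∈ R ↔ a x = c y ∧ ∀ z ∈ range a ⊓ range b, B z x = 0 := by
      rw [hR, Submodule.mem_inf, mem_P, Submodule.mem_comap, fst_apply, ← orth_inf,
        mem_orthogonal_iff]
    rw [this]
    constructor
    · rintro ⟨⟨⟨x, y⟩, hxy⟩, h₁, h₂⟩
      obtain ⟨rfl, rfl⟩ := Prod.ext_iff.1 h₂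
      refine ⟨(mem_P x y).1 hxy, ?_⟩
      rintro z ⟨⟨s, hs⟩, ⟨t, rfl⟩⟩
      have hst : (s + τ t, t) ∈ P := by rw [mem_P, map_add, hs, hc, add_comm]
      exact hAlt.eq_iff.1 (LinearMap.congr_fun h₁ ⟨_, hst⟩)
    · rintro ⟨hxy, h₁⟩
      refine ⟨⟨(x, y), (mem_P x y).2 hxy⟩, ?_, rfl⟩
      ext ⟨⟨s, t⟩, hst⟩
      refine hAlt.eq_iff.1 (h₁ (b t) ⟨⟨s - τ t, ?_⟩, ⟨t, rfl⟩⟩)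
      rw [map_sub, (mem_P s t).1 hst, hc, add_sub_cancel_left]
  have map_R : R.map (fst K V V) = ker a ⊔ ker b := by
    refine le_antisymm ?_ ?_
    · rintro _ ⟨p, hp, rfl⟩
      exact hp.2
    · intro x hx
      obtain ⟨s, hs, t, ht, rfl⟩ := Submodule.mem_sup.1 hx
      refine ⟨(s + t, t), ⟨(mem_P _ _).2 ?_, hx⟩, rfl⟩
      rw [mem_ker] at hs ht
      have : τ t = t := sub_eq_zero.1 ht
      rw [map_add, hs, zero_add, hc, ht, this, add_zero]
  have inf_R : R ⊓ ker (fst K V V) = (ker c).map (inr K V V) := by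
    ext ⟨x, y⟩
    constructor
    · rintro ⟨⟨h₁, -⟩, h₂⟩
      obtain rfl : x = 0 := h₂
      exact ⟨y, by simpa using ((mem_P _ _).1 h₁).symm, rfl⟩
    · rintro ⟨z, hz, h₁⟩
      obtain ⟨rfl, rfl⟩ := Prod.ext_iff.1 h₁
      refine ⟨⟨(mem_P _ _).2 ?_, (ker a ⊔ ker b).zero_mem⟩, rfl⟩
      exact (map_zero a).trans (mem_ker.1 hz).symm
  have finrank_R := finrank_map_add_finrank_inf_ker (fst K V V) R
  rw [map_R, inf_R, (Submodule.equivMapOfInjective (inr K V V) inr_injective _).finrank_eq.symm]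
    at finrank_R
  have hEven := ω_alt.even_finrank_add_finrank_ker
  rw [← Submodule.finrank_map_subtype_eq, ker_ω, ← finrank_R, finrank_P] at hEven
  have h_sup_inf := Submodule.finrank_sup_add_finrank_inf_eq (ker a) (ker b)
  rw [Nat.even_iff] at *
  omega

end LinearMap

/-- Dye: for a quadratic refinement `q` of a nondegenerate alternating form
`B`, the map `O(q) → ℤ/2ℤ`, `σ ↦ dim_{F₂} V^σ (mod 2)` is a group homomorphism:
`dim V^{στ} ≡ dim V^σ + dim V^τ (mod 2)` for all `σ, τ ∈ O(q)`. -/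
theorem stmt6 (V : Type*) [AddCommGroup V] [Module (ZMod 2) V]
    [FiniteDimensional (ZMod 2) V]
    (B : V →ₗ[ZMod 2] V →ₗ[ZMod 2] ZMod 2)
    (hAlt : ∀ v : V, B v v = 0)
    (hNondeg : ∀ v : V, (∀ w : V, B v w = 0) → v = 0)
    (q : V → ZMod 2)
    (hq : ∀ u w : V, q (u + w) + q u + q w = B u w) :
    ∀ σ τ : V ≃ₗ[ZMod 2] V,
      (∀ u w, B (σ u) (σ w) = B u w) → (∀ x : V, q (σ x) = q x) →
      (∀ u w, B (τ u) (τ w) = B u w) → (∀ x : V, q (τ x) = q x) →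
      (fixedRank (τ.trans σ) : ZMod 2) = (fixedRank σ : ZMod 2) + (fixedRank τ : ZMod 2) := by
  intro σ τ hσ hqσ hτ hqτ
  have hB : LinearMap.BilinForm.Nondegenerate B :=
    (LinearMap.IsRefl.nondegenerate_iff_separatingLeft
      (LinearMap.IsAlt.isRefl hAlt)).2 hNondeg
  have sub_eq_add' (u w : V) : u - w = u + w := by
    rw [sub_eq_add_neg, neg_eq_of_add_eq_zero_left]
    rw [← two_smul (ZMod 2) w, show (2 : ZMod 2) = 0 from rfl, zero_smul]
  have key := LinearMap.BilinForm.even_finrank_fixed hAlt hB σ τ hσ hτ (by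
    intro x y hxy
    have h₁ : σ (x + τ y) = x + y := by
      rw [← sub_eq_add', ← sub_eq_add', map_sub]
      rw [sub_eq_sub_iff_add_eq_add] at hxy ⊢
      rw [← sub_eq_zero] at hxy ⊢
      rw [← hxy]
      abel
    have h₂ := hqσ (x + τ y)
    rw [h₁] at h₂
    rw [map_sub, ← hq, ← hq, h₂, hqτ]
    ring)
  have key' := (ZMod.natCast_eq_zero_iff_even).2 key
  push_cast at key'
  exact (CharTwo.add_eq_zero.1 key').symm
end
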